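/- (i) A normal distributive left ∇-algebra A (i.e., ∇a ≤ a for all a) is simple — its only congruences are the identity relation and the full relation — if and only if for every x ∈ A with x ≠ 1 there exists k ∈ ℕ such that ∇^k x = 0. (ii) A normal distributive right ∇-algebra A (i.e., a ≤ ∇a for all a) is simple if and only if for every x ∈ A with x ≠ 1 there exists k ∈ ℕ such that □^k x = 0. -/

import Mathlib

/-- A congruence on a ∇-algebra: an equivalence relation compatible with
`⊓`, `⊔`, `∇` and `→`. -/
def IsNablaCong {A : Type*} [Lattice A]
    (nab : A → A) (arr : A → A → A) (θ : A → A → Prop) : Prop :=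
  Equivalence θ ∧
    (∀ a b c d : A, θ a b → θ c d → θ (a ⊓ c) (b ⊓ d)) ∧
    (∀ a b c d : A, θ a b → θ c d → θ (a ⊔ c) (b ⊔ d)) ∧
    (∀ a b : A, θ a b → θ (nab a) (nab b)) ∧
    (∀ a b c d : A, θ a b → θ c d → θ (arr a c) (arr b d))

/-- The relation identifying `a` and `b` when they agree below some member of the sequence `u`;
if `u` generates a filter closed under `∇` and `□`, this is the associated congruence. -/
def AgreeBelow {A : Type*} [Lattice A] (u : ℕ → A) (a b : A) : Prop :=
  ∃ k, a ⊓ u k ≤ b ∧ b ⊓ u k ≤ a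

section Lattice

variable {A : Type*} [Lattice A] {u : ℕ → A}

theorem agreeBelow_equivalence (hu : Antitone u) : Equivalence (AgreeBelow u) where
  refl _ := ⟨0, inf_le_left, inf_le_left⟩
  symm := fun ⟨k, h, h'⟩ => ⟨k, h', h⟩
  trans := by
    rintro a b c ⟨k, hab, hba⟩ ⟨l, hbc, hcb⟩
    have hk : u (max k l) ≤ u k := hu (le_max_left k l)
    have hl : u (max k l) ≤ u l := hu (le_max_right k l)
    exact ⟨max k l,
      (le_inf ((inf_le_inf_left a hk).trans hab) (inf_le_right.trans hl)).trans hbc,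
      (le_inf ((inf_le_inf_left c hl).trans hcb) (inf_le_right.trans hk)).trans hba⟩

theorem AgreeBelow.exists_common (hu : Antitone u) {a b c d : A}
    (hab : AgreeBelow u a b) (hcd : AgreeBelow u c d) :
    ∃ k, (a ⊓ u k ≤ b ∧ b ⊓ u k ≤ a) ∧ c ⊓ u k ≤ d ∧ d ⊓ u k ≤ c := by
  obtain ⟨k, hab, hba⟩ := hab
  obtain ⟨l, hcd, hdc⟩ := hcd
  have hk : u (max k l) ≤ u k := hu (le_max_left k l)
  have hl : u (max k l) ≤ u l := hu (le_max_right k l)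
  exact ⟨max k l,
    ⟨(inf_le_inf_left a hk).trans hab, (inf_le_inf_left b hk).trans hba⟩,
    (inf_le_inf_left c hl).trans hcd, (inf_le_inf_left d hl).trans hdc⟩

end Lattice

section NablaAlgebra

variable {A : Type*} {nab : A → A} {arr : A → A → A}

theorem arr_inf_le_arr [Lattice A] (adj : ∀ a b c : A, nab c ⊓ a ≤ b ↔ c ≤ arr a b)
    (ninf : ∀ a b : A, nab (a ⊓ b) = nab a ⊓ nab b) {a b c d f g : A}
    (hg : nab g ≤ f) (hba : b ⊓ f ≤ a) (hcd : c ⊓ f ≤ d) :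
    arr a c ⊓ g ≤ arr b d := by
  rw [← adj, ninf]
  have hf : nab (arr a c) ⊓ nab g ⊓ b ≤ f := inf_le_left.trans (inf_le_right.trans hg)
  have ha : nab (arr a c) ⊓ nab g ⊓ b ≤ a := (le_inf inf_le_right hf).trans hba
  have hc : nab (arr a c) ⊓ nab g ⊓ b ≤ c :=
    (le_inf (inf_le_left.trans inf_le_left) ha).trans ((adj a c _).mpr le_rfl)
  exact (le_inf hc hf).trans hcd

theorem isNablaCong_agreeBelow [DistribLattice A]
    (adj : ∀ a b c : A, nab c ⊓ a ≤ b ↔ c ≤ arr a b)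
    (ninf : ∀ a b : A, nab (a ⊓ b) = nab a ⊓ nab b) {u : ℕ → A} (hu : Antitone u)
    (hbox : ∀ k, nab (u (k + 1)) ≤ u k) (hnab : ∀ k, u (k + 1) ≤ nab (u k)) :
    IsNablaCong nab arr (AgreeBelow u) := by
  have nmono : Monotone nab := fun a b h => by
    rw [← inf_eq_left.mpr h, ninf]
    exact inf_le_right
  have hnab_inf : ∀ {a b : A} {k : ℕ}, a ⊓ u k ≤ b → nab a ⊓ u (k + 1) ≤ nab b := by
    intro a b k h
    exact (inf_le_inf_left _ (hnab k)).trans ((ninf a (u k)).symm.le.trans (nmono h))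
  refine ⟨agreeBelow_equivalence hu, ?_, ?_, ?_, ?_⟩
  · intro a b c d hab hcd
    obtain ⟨k, ⟨hab, hba⟩, hcd, hdc⟩ := hab.exists_common hu hcd
    refine ⟨k, ?_, ?_⟩ <;> rw [inf_inf_distrib_right]
    exacts [inf_le_inf hab hcd, inf_le_inf hba hdc]
  · intro a b c d hab hcd
    obtain ⟨k, ⟨hab, hba⟩, hcd, hdc⟩ := hab.exists_common hu hcd
    refine ⟨k, ?_, ?_⟩ <;> rw [inf_sup_right]
    exacts [sup_le_sup hab hcd, sup_le_sup hba hdc]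
  · rintro a b ⟨k, hab, hba⟩
    exact ⟨k + 1, hnab_inf hab, hnab_inf hba⟩
  · intro a b c d hab hcd
    obtain ⟨k, ⟨hab, hba⟩, hcd, hdc⟩ := hab.exists_common hu hcd
    exact ⟨k + 1, arr_inf_le_arr adj ninf (hbox k) hba hcd,
      arr_inf_le_arr adj ninf (hbox k) hab hdc⟩

theorem exists_eq_bot_of_simple [DistribLattice A] [BoundedOrder A]
    (adj : ∀ a b c : A, nab c ⊓ a ≤ b ↔ c ≤ arr a b)
    (ninf : ∀ a b : A, nab (a ⊓ b) = nab a ⊓ nab b)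
    (simple : ∀ θ : A → A → Prop, IsNablaCong nab arr θ → θ = (· = ·) ∨ θ = fun _ _ => True)
    {u : ℕ → A} (hu : Antitone u)
    (hbox : ∀ k, nab (u (k + 1)) ≤ u k) (hnab : ∀ k, u (k + 1) ≤ nab (u k))
    (h0 : u 0 ≠ ⊤) : ∃ k, u k = ⊥ := by
  rcases simple _ (isNablaCong_agreeBelow adj ninf hu hbox hnab) with h | h
  · have : AgreeBelow u (u 0) ⊤ := ⟨0, le_top, inf_le_right⟩
    rw [h] at this
    exact absurd this h0
  · have : AgreeBelow u ⊤ ⊥ := by rw [h]; trivial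
    obtain ⟨k, hk, -⟩ := this
    exact ⟨k, by simpa using hk⟩

theorem arr_self [Lattice A] [BoundedOrder A]
    (adj : ∀ a b c : A, nab c ⊓ a ≤ b ↔ c ≤ arr a b) (a : A) : arr a a = ⊤ :=
  top_le_iff.mp ((adj a a ⊤).mp inf_le_right)

theorem le_of_arr_eq_top [Lattice A] [BoundedOrder A]
    (adj : ∀ a b c : A, nab c ⊓ a ≤ b ↔ c ≤ arr a b) (ntop : nab ⊤ = ⊤) {a b : A}
    (h : arr a b = ⊤) : a ≤ b := by
  simpa [ntop] using (adj a b ⊤).mpr h.ge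

theorem IsNablaCong.exists_ne_top [Lattice A] [BoundedOrder A]
    (adj : ∀ a b c : A, nab c ⊓ a ≤ b ↔ c ≤ arr a b) (ntop : nab ⊤ = ⊤)
    {θ : A → A → Prop} (hθ : IsNablaCong nab arr θ) (hne : θ ≠ (· = ·)) :
    ∃ x, x ≠ ⊤ ∧ θ x ⊤ := by
  obtain ⟨heq, -, -, -, harr⟩ := hθ
  by_contra! h
  have hle : ∀ {a b : A}, θ a b → a ≤ b := by
    intro a b hab
    refine le_of_arr_eq_top adj ntop (by_contra fun hx => h _ hx ?_)
    have := harr a b b b hab (heq.refl b)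
    rwa [arr_self adj] at this
  refine hne (funext₂ fun a b => propext ⟨fun hab => ?_, ?_⟩)
  · exact (hle hab).antisymm (hle (heq.symm hab))
  · rintro rfl
    exact heq.refl a

theorem IsNablaCong.eq_true_of_bot_top [Lattice A] [BoundedOrder A]
    {θ : A → A → Prop} (hθ : IsNablaCong nab arr θ) (h : θ ⊥ ⊤) : θ = fun _ _ => True := by
  obtain ⟨heq, hinf, -⟩ := hθ
  have hbot : ∀ a, θ ⊥ a := fun a => by
    simpa using hinf ⊥ ⊤ a a h (heq.refl a)
  exact funext₂ fun a b => eq_true (heq.trans (heq.symm (hbot a)) (hbot b))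

theorem simple_of_exists_iterate_eq_bot [Lattice A] [BoundedOrder A]
    (adj : ∀ a b c : A, nab c ⊓ a ≤ b ↔ c ≤ arr a b) (ntop : nab ⊤ = ⊤)
    {f : A → A} (ftop : f ⊤ = ⊤)
    (hf : ∀ θ : A → A → Prop, IsNablaCong nab arr θ → ∀ a b, θ a b → θ (f a) (f b))
    (hbot : ∀ x : A, x ≠ ⊤ → ∃ k : ℕ, f^[k] x = ⊥)
    (θ : A → A → Prop) (hθ : IsNablaCong nab arr θ) :
    θ = (· = ·) ∨ θ = fun _ _ => True := by
  refine or_iff_not_imp_left.mpr fun hne => ?_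
  obtain ⟨x, hx, hxθ⟩ := hθ.exists_ne_top adj ntop hne
  obtain ⟨k, hk⟩ := hbot x hx
  have hiter : ∀ n : ℕ, θ (f^[n] x) ⊤ := by
    intro n
    induction n with
    | zero => exact hxθ
    | succ n ih => simpa only [Function.iterate_succ_apply', ftop] using hf θ hθ _ _ ih
  exact hθ.eq_true_of_bot_top (hk ▸ hiter k)

end NablaAlgebra

/-- (i) A normal distributive left ∇-algebra (`∇a ≤ a`) is
simple iff for every `x ≠ ⊤` there is `k` with `∇^k x = ⊥`. (ii) A normal
distributive right ∇-algebra (`a ≤ ∇a`) is simple iff for every `x ≠ ⊤`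
there is `k` with `□^k x = ⊥`. Here `□ = arr ⊤`. -/
theorem simple_left_right_characterization {A : Type*}
    [DistribLattice A] [BoundedOrder A]
    (nab : A → A) (arr : A → A → A)
    (adj : ∀ a b c : A, nab c ⊓ a ≤ b ↔ c ≤ arr a b)
    (ntop : nab ⊤ = ⊤) (ninf : ∀ a b : A, nab (a ⊓ b) = nab a ⊓ nab b) :
    ((∀ a : A, nab a ≤ a) →
      ((∀ θ : A → A → Prop, IsNablaCong nab arr θ →
          θ = (· = ·) ∨ θ = fun _ _ => True) ↔
        (∀ x : A, x ≠ ⊤ → ∃ k : ℕ, nab^[k] x = ⊥))) ∧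
    ((∀ a : A, a ≤ nab a) →
      ((∀ θ : A → A → Prop, IsNablaCong nab arr θ →
          θ = (· = ·) ∨ θ = fun _ _ => True) ↔
        (∀ x : A, x ≠ ⊤ → ∃ k : ℕ, (arr ⊤)^[k] x = ⊥))) := by
  refine ⟨fun left => ⟨fun simple x hx => ?_, ?_⟩, fun right => ⟨fun simple x hx => ?_, ?_⟩⟩
  · have hsucc : ∀ k, nab^[k + 1] x = nab (nab^[k] x) := fun k =>
      Function.iterate_succ_apply' nab k x
    refine exists_eq_bot_of_simple (u := fun k => nab^[k] x) adj ninf simple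
      (antitone_nat_of_succ_le fun k => ?_) (fun k => ?_) (fun k => (hsucc k).le) hx
    · exact (hsucc k).le.trans (left _)
    · exact (left _).trans ((hsucc k).le.trans (left _))
  · exact simple_of_exists_iterate_eq_bot adj ntop ntop fun θ hθ => hθ.2.2.2.1
  · have nab_box : ∀ a, nab (arr ⊤ a) ≤ a := fun a => by
      simpa using (adj ⊤ a (arr ⊤ a)).mpr le_rfl
    have hsucc : ∀ k, (arr ⊤)^[k + 1] x = arr ⊤ ((arr ⊤)^[k] x) := fun k =>
      Function.iterate_succ_apply' (arr ⊤) k x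
    have hnab : ∀ k, nab ((arr ⊤)^[k + 1] x) ≤ (arr ⊤)^[k] x := fun k => by
      rw [hsucc]
      exact nab_box _
    have hle : ∀ k, (arr ⊤)^[k + 1] x ≤ (arr ⊤)^[k] x := fun k => (right _).trans (hnab k)
    exact exists_eq_bot_of_simple (u := fun k => (arr ⊤)^[k] x) adj ninf simple
      (antitone_nat_of_succ_le hle) hnab (fun k => (hle k).trans (right _)) hx
  · exact simple_of_exists_iterate_eq_bot adj ntop (arr_self adj ⊤)
      fun θ hθ a b => hθ.2.2.2.2 ⊤ ⊤ a b (hθ.1.refl ⊤)
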